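/- If ω ∈ W_0 and a ∈ S_ω satisfies a_1 ≠ a_2, then the vector ω_1·a := (a_2, a_1, a_3, …, a_{N-1}) lies in S_{ω ω_1}. -/

import Mathlib

open Matrix

noncomputable section

namespace IH

variable (p : ℕ) [Fact p.Prime]

/-- `\bar{𝔽}_p`, an algebraic closure of the residue field. -/
abbrev kb := AlgebraicClosure (ZMod p)

variable (N : ℕ)

/-- `G = GL_N(F)` with `F = ℚ_p`. -/
abbrev GG := GL (Fin N) ℚ_[p]
/-- `GL_N(O_F)` (as an abstract group, mapping onto `K ⊆ G`). -/
abbrev MM := GL (Fin N) ℤ_[p]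
/-- `GL_N(k_F)`. -/
abbrev Gk := GL (Fin N) (ZMod p)

/-- The inclusion `GL_N(O_F) → GL_N(F)`. -/
def iotaM : MM p N →* GG p N := Matrix.GeneralLinearGroup.map (PadicInt.Coe.ringHom)

/-- The reduction map `red : GL_N(O_F) → GL_N(k_F)`. -/
def redM : MM p N →* Gk p N := Matrix.GeneralLinearGroup.map (PadicInt.toZMod)

/-- Elements of `GL_N(O_F)` whose reduction is upper triangular: the Iwahori condition. -/
def Ipre : Set (MM p N) :=
  {m | ∀ i j : Fin N, j < i → ((redM p N m : Matrix (Fin N) (Fin N) (ZMod p)) i j = 0)}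

/-- Elements of `GL_N(O_F)` whose reduction is upper triangular unipotent: pro-p Iwahori. -/
def I1pre : Set (MM p N) :=
  {m | m ∈ Ipre p N ∧ ∀ i : Fin N, ((redM p N m : Matrix (Fin N) (Fin N) (ZMod p)) i i = 1)}

/-- Elements of `GL_N(O_F)` reducing to the identity: `K_1 = ker red`. -/
def K1pre : Set (MM p N) := {m | redM p N m = 1}

/-- `K = GL_N(O_F)` as a subset of `G`. -/
def Kset : Set (GG p N) := Set.range (iotaM p N)
/-- The Iwahori subgroup `I ⊆ G`. -/
def Iset : Set (GG p N) := iotaM p N '' Ipre p N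
/-- The pro-p Iwahori subgroup `I_1 ⊆ G`. -/
def I1set : Set (GG p N) := iotaM p N '' I1pre p N
/-- `K_1 ⊆ G`. -/
def K1set : Set (GG p N) := iotaM p N '' K1pre p N

/-- The uniformizer `ϖ = p` as a unit of `ℚ_p`. -/
def pU : ℚ_[p]ˣ :=
  Units.mk0 (p : ℚ_[p]) (by
    have h := (Fact.out : p.Prime).ne_zero
    exact_mod_cast Nat.cast_ne_zero.mpr h)

/-- Scalar matrices as elements of `G`. -/
def scalarGL (u : ℚ_[p]ˣ) : GG p N :=
  Units.map (algebraMap ℚ_[p] (Matrix (Fin N) (Fin N) ℚ_[p])).toMonoidHom u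

/-- The central element `ϖ^n · Id`. -/
def piSc (n : ℤ) : GG p N := scalarGL p N (pU p ^ n)

/-- Invertible diagonal matrices. -/
def diagGL (d : Fin N → ℚ_[p]ˣ) : GG p N where
  val := Matrix.diagonal fun i => (d i : ℚ_[p])
  inv := Matrix.diagonal fun i => (((d i)⁻¹ : ℚ_[p]ˣ) : ℚ_[p])
  val_inv := by
    rw [Matrix.diagonal_mul_diagonal]
    simp
  inv_val := by
    rw [Matrix.diagonal_mul_diagonal]
    simp

/-- extend `a ∈ ℤ^{N-1}` by `0` in the last coordinate. -/
def expo (a : Fin (N - 1) → ℤ) : Fin N → ℤ :=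
  fun i => if h : (i : ℕ) < N - 1 then a ⟨i, h⟩ else 0

/-- `t_a = diag(ϖ^{a_1}, …, ϖ^{a_{N-1}}, 1)`. -/
def tGL (a : Fin (N - 1) → ℤ) : GG p N :=
  diagGL p N fun i => pU p ^ (expo N a i)

/-- The permutation matrix of `σ` (with `permGL σ · e_j = e_{σ j}`, so that
`permGL` is a group homomorphism). -/
def permGL (σ : Equiv.Perm (Fin N)) : GG p N where
  val := (σ⁻¹).permMatrix ℚ_[p]
  inv := σ.permMatrix ℚ_[p]
  val_inv := by
    show ((σ⁻¹).toPEquiv.toMatrix : Matrix (Fin N) (Fin N) ℚ_[p]) * σ.toPEquiv.toMatrix = 1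
    rw [← PEquiv.toMatrix_trans, ← Equiv.toPEquiv_trans]
    simp only [Equiv.self_trans_symm, Equiv.symm_trans_self, Equiv.Perm.inv_def]
    rw [Equiv.toPEquiv_refl, PEquiv.toMatrix_refl]
  inv_val := by
    show (σ.toPEquiv.toMatrix : Matrix (Fin N) (Fin N) ℚ_[p]) * (σ⁻¹).toPEquiv.toMatrix = 1
    rw [← PEquiv.toMatrix_trans, ← Equiv.toPEquiv_trans]
    simp only [Equiv.self_trans_symm, Equiv.symm_trans_self, Equiv.Perm.inv_def]
    rw [Equiv.toPEquiv_refl, PEquiv.toMatrix_refl]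

/-- `ω t_a`. -/
def wS (σ : Equiv.Perm (Fin N)) (a : Fin (N - 1) → ℤ) : GG p N :=
  permGL p N σ * tGL p N a

/-- The permutation `ω₂` (as a matrix: first row block `(0, I_{N-1})`, last row `(1,0,…,0)`). -/
def w2 : Equiv.Perm (Fin N) := (finRotate N)⁻¹

/-- `γ = ω₂ · diag(ϖ, I_{N-1})`. -/
def gammaGL : GG p N :=
  permGL p N (w2 N) * tGL p N fun i => if (i : ℕ) = 0 then 1 else 0

/-- `S_ω = {a ∈ ℤ^{N-1} : (ω t_a) I (ω t_a)⁻¹ ∩ K ⊆ I}`. -/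
def Sset (σ : Equiv.Perm (Fin N)) : Set (Fin (N - 1) → ℤ) :=
  {a | ∀ g ∈ Iset p N,
    wS p N σ a * g * (wS p N σ a)⁻¹ ∈ Kset p N →
    wS p N σ a * g * (wS p N σ a)⁻¹ ∈ Iset p N}

/-- The unit of `k_F^×` attached to a nonzero element of `k_F` (junk value `1` at `0`). -/
def unitOf (x : ZMod p) : (ZMod p)ˣ :=
  if h : x = 0 then 1 else Units.mk0 x h

/-- The diagonal of the reduction of `m`, as an `N`-tuple of units of `k_F`. -/
def diagOf (m : MM p N) : Fin N → (ZMod p)ˣ :=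
  fun i => unitOf p ((redM p N m : Matrix (Fin N) (Fin N) (ZMod p)) i i)

/-- The transformation rule for functions in `H_{IZ}(χ)`, where the character `χ` of `I`
is given by the character `ξ` of the torus `(k_F^×)^N` through the diagonal of the
reduction, extended to `IZ` by `χ(ϖ) = 1`. -/
def HTransf (ξ : (Fin N → (ZMod p)ˣ) →* (kb p)ˣ) (φ : GG p N → kb p) : Prop :=
  ∀ (n₁ n₂ : ℤ) (m₁ m₂ : MM p N), m₁ ∈ Ipre p N → m₂ ∈ Ipre p N → ∀ g : GG p N,
    φ (piSc p N n₁ * iotaM p N m₁ * g * (piSc p N n₂ * iotaM p N m₂)) =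
      (ξ (diagOf p N m₁) : kb p) * (ξ (diagOf p N m₂) : kb p) * φ g

/-- `φ` is supported on the double coset `IZ x I`. -/
def SuppDouble (φ : GG p N → kb p) (x : GG p N) : Prop :=
  ∀ g : GG p N, φ g ≠ 0 → ∃ (n : ℤ) (m₁ m₂ : MM p N), m₁ ∈ Ipre p N ∧ m₂ ∈ Ipre p N ∧
    g = piSc p N n * iotaM p N m₁ * x * iotaM p N m₂

/-- Membership in `H_{IZ}(χ)`: the transformation rule together with support in
finitely many double cosets `IZ g I`. -/
def HMem (ξ : (Fin N → (ZMod p)ˣ) →* (kb p)ˣ) (φ : GG p N → kb p) : Prop :=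
  HTransf p N ξ φ ∧
  ∃ S : Finset (GG p N), ∀ g : GG p N, φ g ≠ 0 →
    ∃ s ∈ S, ∃ (n : ℤ) (m₁ m₂ : MM p N), m₁ ∈ Ipre p N ∧ m₂ ∈ Ipre p N ∧
      g = piSc p N n * iotaM p N m₁ * s * iotaM p N m₂

section Rep

variable {V : Type} [AddCommGroup V] [Module (kb p) V]

/-- `σ` (here `ρ`) is irreducible. -/
def IsIrred (ρ : Representation (kb p) (Gk p N) V) : Prop :=
  (∃ v : V, v ≠ 0) ∧
  ∀ W : Submodule (kb p) V, (∀ g v, v ∈ W → ρ g v ∈ W) → W = ⊥ ∨ W = ⊤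

/-- Membership in the compact induction `ind_{KZ}^G σ`: left `KZ`-equivariance
(where `ϖ` acts trivially), support in finitely many cosets `KZ g`, and smoothness. -/
def IndMem (ρ : Representation (kb p) (Gk p N) V) (f : GG p N → V) : Prop :=
  (∀ (n : ℤ) (m : MM p N) (g : GG p N),
      f (piSc p N n * iotaM p N m * g) = ρ (redM p N m) (f g)) ∧
  (∃ S : Finset (GG p N), ∀ g : GG p N, f g ≠ 0 →
      ∃ s ∈ S, ∃ (n : ℤ) (m : MM p N), g = piSc p N n * iotaM p N m * s) ∧
  (∃ U : Subgroup (GG p N), IsOpen (U : Set (GG p N)) ∧ ∀ u ∈ U, ∀ g, f (g * u) = f g)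

/-- `f` is invariant under right translation by `I_1`. -/
def IsI1Inv (f : GG p N → V) : Prop :=
  ∀ u ∈ I1set p N, ∀ g, f (g * u) = f g

/-- The defining property of the standard function `f_{ω,a}`: an `I_1`-invariant member of
`ind_{KZ}^G σ` supported on `KZ t_a I_1` with value `v₀` at `ω t_a`. -/
def IsStd (ρ : Representation (kb p) (Gk p N) V) (v₀ : V)
    (σp : Equiv.Perm (Fin N)) (a : Fin (N - 1) → ℤ) (f : GG p N → V) : Prop :=
  IndMem p N ρ f ∧ IsI1Inv p N f ∧
  (∀ g : GG p N, f g ≠ 0 → ∃ (n : ℤ) (m : MM p N) (u : GG p N), u ∈ I1set p N ∧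
      g = piSc p N n * iotaM p N m * tGL p N a * u) ∧
  f (wS p N σp a) = v₀

/-- `R` is a set of representatives for `I_1/(I_1 ∩ g⁻¹ I_1 g)`. -/
def IsRepSet (g : GG p N) (R : Finset (GG p N)) : Prop :=
  (↑R ⊆ I1set p N) ∧
  ∀ x ∈ I1set p N, ∃! r : GG p N, r ∈ R ∧
    (r⁻¹ * x ∈ I1set p N ∧ g * (r⁻¹ * x) * g⁻¹ ∈ I1set p N)

/-- The Hecke operator: `f|T_g = ∑_{r} (r g⁻¹)·f`, where `(h·f)(x) = f(xh)`. -/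
def hk (g : GG p N) (R : Finset (GG p N)) (f : GG p N → V) : GG p N → V :=
  fun x => ∑ r ∈ R, f (x * r * g⁻¹)

end Rep


theorem coe_wS_conj_apply (σ : Equiv.Perm (Fin N)) (a : Fin (N - 1) → ℤ) (g : GG p N)
    (i j : Fin N) :
    ((wS p N σ a * g * (wS p N σ a)⁻¹ : GG p N) : Matrix (Fin N) (Fin N) ℚ_[p]) (σ i) (σ j) =
      (p : ℚ_[p]) ^ (expo N a i - expo N a j) * (g : Matrix (Fin N) (Fin N) ℚ_[p]) i j := by
  have hp : (p : ℚ_[p]) ≠ 0 := (pU p).ne_zero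
  have key : ((wS p N σ a * g * (wS p N σ a)⁻¹ : GG p N) : Matrix (Fin N) (Fin N) ℚ_[p]) =
      ((σ⁻¹).toPEquiv.toMatrix * ((Matrix.diagonal fun i => (p : ℚ_[p]) ^ expo N a i) *
        (g : Matrix (Fin N) (Fin N) ℚ_[p]) *
        Matrix.diagonal fun i => ((p : ℚ_[p]) ^ expo N a i)⁻¹)) * σ.toPEquiv.toMatrix := by
    have hw : wS p N σ a * g * (wS p N σ a)⁻¹ =
        permGL p N σ * (tGL p N a * g * (tGL p N a)⁻¹) * (permGL p N σ)⁻¹ := by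
      simp only [wS]
      group
    have ht : ((tGL p N a : GG p N) : Matrix (Fin N) (Fin N) ℚ_[p]) =
        Matrix.diagonal fun i => (p : ℚ_[p]) ^ expo N a i := by
      simp [tGL, diagGL, pU]
    have ht' : (((tGL p N a)⁻¹ : GG p N) : Matrix (Fin N) (Fin N) ℚ_[p]) =
        Matrix.diagonal fun i => ((p : ℚ_[p]) ^ expo N a i)⁻¹ := by
      change Matrix.diagonal _ = _
      simp [pU]
    rw [hw, Units.val_mul, Units.val_mul, Units.val_mul, Units.val_mul, ht, ht']
    rfl
  rw [key, PEquiv.mul_toMatrix_toPEquiv, PEquiv.toMatrix_toPEquiv_mul, Matrix.submatrix_apply,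
    Matrix.submatrix_apply, Matrix.mul_diagonal, Matrix.diagonal_mul, zpow_sub₀ hp]
  simp
  ring

/-- The transvection `1 + c E_{ij}` as an element of `GL_N(O_F)`. -/
def transvectionGL (i j : Fin N) (hij : i ≠ j) (c : ℤ_[p]) : MM p N where
  val := Matrix.transvection i j c
  inv := Matrix.transvection i j (-c)
  val_inv := by simp [Matrix.transvection_mul_transvection_same i j hij]
  inv_val := by simp [Matrix.transvection_mul_transvection_same i j hij]

theorem coe_iotaM_apply (m : MM p N) (i j : Fin N) :
    (iotaM p N m : Matrix (Fin N) (Fin N) ℚ_[p]) i j =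
      ((m : Matrix (Fin N) (Fin N) ℤ_[p]) i j : ℚ_[p]) := rfl

theorem coe_redM_apply (m : MM p N) (i j : Fin N) :
    (redM p N m : Matrix (Fin N) (Fin N) (ZMod p)) i j =
      PadicInt.toZMod ((m : Matrix (Fin N) (Fin N) ℤ_[p]) i j) := rfl

theorem toZMod_p_pow {d : ℕ} (hd : d ≠ 0) : PadicInt.toZMod ((p : ℤ_[p]) ^ d) = 0 := by
  simp [hd]

/-- The combinatorial description of `S_ω`: `a ∈ S_ω` if and only if conjugation by `ω t_a`
contracts every root subgroup of `I` that it sends below the diagonal. -/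
theorem mem_Sset_iff (σ : Equiv.Perm (Fin N)) (a : Fin (N - 1) → ℤ) :
    a ∈ Sset p N σ ↔ ∀ i j : Fin N, σ j < σ i →
      expo N a j ≤ expo N a i ∧ (i < j → expo N a j < expo N a i) := by
  have hp : (p : ℚ_[p]) ≠ 0 := (pU p).ne_zero
  constructor
  · intro ha i j hσ
    have hij : i ≠ j := by rintro rfl; exact lt_irrefl _ hσ
    by_contra hcon
    have hle : expo N a i ≤ expo N a j := by grind
    obtain ⟨d, hd⟩ := Int.eq_ofNat_of_zero_le (sub_nonneg.mpr hle)
    have hgI : transvectionGL p N i j hij ((p : ℤ_[p]) ^ d) ∈ Ipre p N := by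
      intro k l hlk
      rw [coe_redM_apply]
      change PadicInt.toZMod (((1 : Matrix (Fin N) (Fin N) ℤ_[p]) +
        Matrix.single i j ((p : ℤ_[p]) ^ d)) k l) = 0
      rw [Matrix.add_apply, Matrix.one_apply_ne hlk.ne', zero_add, Matrix.single_apply]
      split_ifs with h
      · obtain ⟨rfl, rfl⟩ := h
        refine toZMod_p_pow p ?_
        rintro rfl
        have := not_lt_of_gt hlk
        grind
      · simp
    have hconj : iotaM p N (transvectionGL p N (σ i) (σ j) hσ.ne' 1) =
        wS p N σ a * iotaM p N (transvectionGL p N i j hij ((p : ℤ_[p]) ^ d)) *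
          (wS p N σ a)⁻¹ := by
      ext k l
      obtain ⟨k, rfl⟩ := σ.surjective k
      obtain ⟨l, rfl⟩ := σ.surjective l
      rw [coe_wS_conj_apply, coe_iotaM_apply, coe_iotaM_apply]
      change ((((1 : Matrix (Fin N) (Fin N) ℤ_[p]) +
          Matrix.single (σ i) (σ j) (1 : ℤ_[p])) (σ k) (σ l) : ℤ_[p]) : ℚ_[p]) =
        _ * ((((1 : Matrix (Fin N) (Fin N) ℤ_[p]) +
          Matrix.single i j ((p : ℤ_[p]) ^ d)) k l : ℤ_[p]) : ℚ_[p])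
      rw [Matrix.add_apply, Matrix.add_apply, Matrix.single_apply, Matrix.single_apply,
        Matrix.one_apply, Matrix.one_apply]
      simp only [EmbeddingLike.apply_eq_iff_eq]
      by_cases h : i = k ∧ j = l
      · obtain ⟨rfl, rfl⟩ := h
        have hs : expo N a i - expo N a j = -(d : ℤ) := by
          rw [← neg_sub, hd]
        simp [hij, hs, hp]
      · by_cases hkl : k = l
        · subst hkl
          simp [h]
        · simp [h, hkl]
    obtain ⟨m, hm, hmeq⟩ := ha _ ⟨_, hgI, rfl⟩ ⟨_, hconj⟩
    have hentry := congrArg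
      (fun g : GG p N => (g : Matrix (Fin N) (Fin N) ℚ_[p]) (σ i) (σ j)) (hmeq.trans hconj.symm)
    simp only [coe_iotaM_apply] at hentry
    have h1 : (m : Matrix (Fin N) (Fin N) ℤ_[p]) (σ i) (σ j) = 1 := by
      rw [PadicInt.ext hentry]
      simp [transvectionGL, Matrix.transvection, hij]
    have h0 := hm (σ i) (σ j) hσ
    rw [coe_redM_apply, h1, map_one] at h0
    exact one_ne_zero h0
  · rintro h _ ⟨g, hg, rfl⟩ ⟨m, hm⟩
    refine ⟨m, fun k l hlk => ?_, hm⟩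
    obtain ⟨i, rfl⟩ := σ.surjective k
    obtain ⟨j, rfl⟩ := σ.surjective l
    obtain ⟨hle, hlt⟩ := h i j hlk
    obtain ⟨d, hd⟩ := Int.eq_ofNat_of_zero_le (sub_nonneg.mpr hle)
    have hentry : (m : Matrix (Fin N) (Fin N) ℤ_[p]) (σ i) (σ j) =
        (p : ℤ_[p]) ^ d * (g : Matrix (Fin N) (Fin N) ℤ_[p]) i j := by
      apply PadicInt.ext
      rw [← coe_iotaM_apply, hm, coe_wS_conj_apply, coe_iotaM_apply, hd]
      simp
    rw [coe_redM_apply, hentry, map_mul]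
    rcases lt_trichotomy i j with hij | rfl | hij
    · rw [toZMod_p_pow p (by have := hlt hij; rintro rfl; grind), zero_mul]
    · exact absurd hlk (lt_irrefl _)
    · rw [← coe_redM_apply, hg i j hij, mul_zero]

theorem expo_comp_swap (n : ℕ) (a : Fin (n + 2) → ℤ) (i : Fin (n + 3)) :
    expo (n + 3) (a ∘ ⇑(Equiv.swap (0 : Fin (n + 2)) 1)) i =
      expo (n + 3) a (Equiv.swap (0 : Fin (n + 3)) 1 i) := by
  cases i using Fin.lastCases with
  | last =>
    rw [Equiv.swap_apply_of_ne_of_ne (by simp [Fin.ext_iff]) (by simp [Fin.ext_iff])]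
    simp [expo]
  | cast i =>
    have hs : Equiv.swap (0 : Fin (n + 3)) 1 i.castSucc =
        (Equiv.swap (0 : Fin (n + 2)) 1 i).castSucc := by
      simp only [Equiv.swap_apply_def, Fin.ext_iff]
      split_ifs <;> simp_all
    rw [hs]
    simp [expo]

/-- if `a ∈ S_ω` and `a₁ ≠ a₂` then `ω₁·a ∈ S_{ω ω₁}`. -/
theorem stmt5 (p : ℕ) [Fact p.Prime] (n : ℕ)
    (ω : Equiv.Perm (Fin (n + 3))) (a : Fin (n + 2) → ℤ)
    (ha : a ∈ Sset p (n + 3) ω) (hne : a 0 ≠ a 1) :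
    (a ∘ ⇑(Equiv.swap (0 : Fin (n + 2)) 1)) ∈
      Sset p (n + 3) (ω * Equiv.swap (0 : Fin (n + 3)) 1) := by
  rw [mem_Sset_iff] at ha ⊢
  intro i j hij
  rw [expo_comp_swap, expo_comp_swap]
  obtain ⟨hle, hlt⟩ := ha _ _ hij
  refine ⟨hle, fun h => ?_⟩
  by_cases h01 : i = 0 ∧ j = 1
  · obtain ⟨rfl, rfl⟩ := h01
    rw [Equiv.swap_apply_left, Equiv.swap_apply_right] at hle ⊢
    refine lt_of_le_of_ne hle ?_
    simpa [expo] using hne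
  · have hs : ∀ x : Fin (n + 3), ((Equiv.swap 0 1 x : Fin (n + 3)) : ℕ) =
        if (x : ℕ) = 0 then 1 else if (x : ℕ) = 1 then 0 else (x : ℕ) := by
      intro x
      simp only [Equiv.swap_apply_def, Fin.ext_iff, Fin.val_zero, Fin.val_one]
      split_ifs <;> rfl
    apply hlt
    rw [Fin.lt_def] at h ⊢
    rw [Fin.ext_iff, Fin.ext_iff, Fin.val_zero, Fin.val_one] at h01
    rw [hs, hs]
    split_ifs <;> omega

end IH
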